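/- arXiv:2303.12679 — 2 statements merged into one kernel-verified Lean document; each statement's English description precedes it below -/
import Mathlib

section
/- Let L be a relational language and F a set of finite irreducible L-structures. Then for every finite L-structure A ∈ Forb_e(F) there exists a finite integer d = d(A) such that for every finite B ∈ Forb_e(F) and every finite k ≥ 1 there exists a finite C ∈ Forb_e(F) satisfying C ⟶ (B)^A_{k,d}. -/
/-!
Statement 1 (Nešetřil–Rödl theorem): Let `L` be a relational language and `F` a set of finite
irreducible `L`-structures. Then for every finite `A ∈ Forb_e(F)` there exists a finite `d = d(A)`
such that for every finite `B ∈ Forb_e(F)` and every `k ≥ 1` there exists a finite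
`C ∈ Forb_e(F)` with `C ⟶ (B)^A_{k,d}`.
-/

open FirstOrder FirstOrder.Language

/-- A bundled `L`-structure. -/
structure FOStr (L : FirstOrder.Language.{0, 0}) : Type 1 where
  carrier : Type
  str : L.Structure carrier

instance {L : FirstOrder.Language.{0, 0}} (M : FOStr L) : L.Structure M.carrier := M.str

/-- An `L`-structure is irreducible if every pair of vertices lies in a common tuple of some
relation. -/
def Irred (L : FirstOrder.Language.{0, 0}) (A : Type) [L.Structure A] : Prop :=
  ∀ u v : A, ∃ (n : ℕ) (R : L.Relations n) (t : Fin n → A),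
    Structure.RelMap R t ∧ (∃ a, t a = u) ∧ (∃ b, t b = v)

/-- `B` is `F`-free: no member of the family `F` embeds into `B`. -/
def FFree {L : FirstOrder.Language.{0, 0}} {ι : Type} (F : ι → FOStr L) (B : Type)
    [L.Structure B] : Prop :=
  ∀ i, IsEmpty ((F i).carrier ↪[L] B)

/-- `C ⟶ (B)^A_{k,l}`: for every colouring of the embeddings of `A` into `C` with `k` colours
there is an embedding `f : B ↪ C` such that the embeddings of `A` into `C` with range inside
`f[B]` receive at most `l` colours. -/
def Arrow (L : FirstOrder.Language.{0, 0}) (C B A : Type) [L.Structure C] [L.Structure B]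
    [L.Structure A] (k l : ℕ) : Prop :=
  ∀ χ : (A ↪[L] C) → Fin k, ∃ f : B ↪[L] C,
    Set.ncard { c : Fin k | ∃ e : A ↪[L] C, Set.range ⇑e ⊆ Set.range ⇑f ∧ χ e = c } ≤ l

theorem ramsey_fin {α : Type} [LinearOrder α] (a : ℕ) :
    ∀ (K : Type) [Finite K] [Nonempty K] (b : ℕ), ∃ N : ℕ, ∀ (V : Finset α), N ≤ V.card →
      ∀ c : Finset α → K, ∃ H ⊆ V, H.card = b ∧ ∃ κ, ∀ s ⊆ H, s.card = a → c s = κ := by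
  induction a with
  | zero =>
    intro K _ _ b
    refine ⟨b, fun V hV c => ?_⟩
    obtain ⟨H, hH, hb⟩ := Finset.exists_subset_card_eq hV
    refine ⟨H, hH, hb, c ∅, fun s _ hs => ?_⟩
    rw [Finset.card_eq_zero.1 hs]
  | succ a ih =>
    intro K _ _ b
    have key : ∀ m : ℕ, ∃ N : ℕ, ∀ (V : Finset α), N ≤ V.card → ∀ c : Finset α → K,
        ∃ H ⊆ V, H.card = m ∧ ∃ d : α → K, ∀ s ⊆ H, s.card = a + 1 →
          ∀ x ∈ s, (∀ y ∈ s, x ≤ y) → c s = d x := by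
      intro m
      induction m with
      | zero =>
        refine ⟨0, fun V _ c => ⟨∅, by simp, by simp, fun _ => Classical.arbitrary K, ?_⟩⟩
        intro s hs _ x hx
        exact absurd (hs hx) (by simp)
      | succ m ihm =>
        obtain ⟨N, hN⟩ := ihm
        obtain ⟨M, hM⟩ := ih K N
        refine ⟨M + 1, fun V hV c => ?_⟩
        have hne : V.Nonempty := by rw [← Finset.card_pos]; omega
        set x := V.min' hne with hx
        have hxV : x ∈ V := Finset.min'_mem _ _
        obtain ⟨H₁, hH₁, hc₁, κ, hκ⟩ := hM (V.erase x)
          (by rw [Finset.card_erase_of_mem hxV]; omega) (fun s => c (insert x s))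
        obtain ⟨H, hH, hc, d, hd⟩ := hN H₁ hc₁.ge c
        have hxH : x ∉ H := fun h => by simpa using hH₁ (hH h)
        refine ⟨insert x H, ?_, by rw [Finset.card_insert_of_notMem hxH, hc],
          Function.update d x κ, ?_⟩
        · intro y hy
          rcases Finset.mem_insert.1 hy with rfl | hy
          · exact hxV
          · exact Finset.mem_of_mem_erase (hH₁ (hH hy))
        · intro s hs hsc y hy hmin
          by_cases hxs : x ∈ s
          · have : y = x := le_antisymm (hmin x hxs) (by
              refine Finset.min'_le _ _ ?_
              rcases Finset.mem_insert.1 (hs hy) with h | h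
              · rw [h]; exact hxV
              · exact Finset.mem_of_mem_erase (hH₁ (hH h)))
            rw [this, Function.update_self]
            have := hκ (s.erase x) (fun z hz => by
              have h1 := Finset.mem_erase.1 hz
              rcases Finset.mem_insert.1 (hs h1.2) with h | h
              · exact absurd h h1.1
              · exact hH h) (by rw [Finset.card_erase_of_mem hxs]; omega)
            simpa [Finset.insert_erase hxs] using this
          · have hyx : y ≠ x := fun h => hxs (h ▸ hy)
            rw [Function.update_of_ne hyx]
            refine hd s (fun z hz => ?_) hsc y hy hmin
            rcases Finset.mem_insert.1 (hs hz) with h | h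
            · exact absurd (h ▸ hz) hxs
            · exact h
    classical
    have := Fintype.ofFinite K
    obtain ⟨N, hN⟩ := key (Fintype.card K * b)
    refine ⟨N, fun V hV c => ?_⟩
    obtain ⟨H, hH, hc, d, hd⟩ := hN V hV c
    obtain ⟨κ, _, hκ⟩ := Finset.exists_le_card_fiber_of_mul_le_card_of_maps_to
      (s := H) (t := (Finset.univ : Finset K)) (f := d) (n := b) (by simp) (by simp) (by simp [hc])
    obtain ⟨H', hH', hb⟩ := Finset.exists_subset_card_eq hκ
    refine ⟨H', fun z hz => hH (Finset.mem_filter.1 (hH' hz)).1, hb, κ, fun s hs hsc => ?_⟩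
    have hne : s.Nonempty := by rw [← Finset.card_pos]; omega
    rw [hd s (fun z hz => (Finset.mem_filter.1 (hH' (hs hz))).1) hsc _ (s.min'_mem hne)
      (fun y hy => s.min'_le y hy)]
    exact (Finset.mem_filter.1 (hH' (hs (s.min'_mem hne)))).2

section PartiteConstruction

open Combinatorics

/-- Relational structure from interpretations of the relation symbols. -/
@[reducible]
def mkStr (L : FirstOrder.Language.{0, 0}) [L.IsRelational] (M : Type)
    (rel : ∀ n, L.Relations n → (Fin n → M) → Prop) : L.Structure M where
  funMap := fun f => isEmptyElim f
  RelMap := fun {n} R t => rel n R t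

/-- Embedding of relational structures. -/
def mkEmb {L : FirstOrder.Language.{0, 0}} [L.IsRelational] {M N : Type} [L.Structure M]
    [L.Structure N] (f : M → N) (hf : Function.Injective f)
    (hr : ∀ (n : ℕ) (R : L.Relations n) (t : Fin n → M),
      Structure.RelMap R (fun j => f (t j)) ↔ Structure.RelMap R t) : M ↪[L] N where
  toFun := f
  inj' := hf
  map_fun' := fun g => isEmptyElim g
  map_rel' := fun R t => hr _ R t

theorem emb_rel {L : FirstOrder.Language.{0, 0}} {M N : Type} [L.Structure M]
    [L.Structure N] (f : M ↪[L] N) {n : ℕ} (R : L.Relations n) (t : Fin n → M) :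
      Structure.RelMap R (fun j => f (t j)) ↔ Structure.RelMap R t :=
  f.map_rel R t

/-- Irreducible subsets of a structure. -/
def IrrSet (L : FirstOrder.Language.{0, 0}) {P : Type} [L.Structure P] (I : Set P) : Prop :=
  ∀ u ∈ I, ∀ v ∈ I, ∃ (n : ℕ) (R : L.Relations n) (t : Fin n → P),
    Structure.RelMap R t ∧ (∀ j, t j ∈ I) ∧ (∃ a, t a = u) ∧ (∃ b, t b = v)

/-- The projection is a homomorphism-embedding. -/
structure HomEmb (L : FirstOrder.Language.{0, 0}) {P X : Type} [L.Structure P] [L.Structure X]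
    (π : P → X) : Prop where
  hom : ∀ (n : ℕ) (R : L.Relations n) (t : Fin n → P), Structure.RelMap R t →
    Structure.RelMap R (fun j => π (t j))
  inj : ∀ (n : ℕ) (R : L.Relations n) (t : Fin n → P), Structure.RelMap R t →
    ∀ i j, π (t i) = π (t j) → t i = t j
  refl : ∀ I : Set P, IrrSet L I → ∀ (n : ℕ) (R : L.Relations n) (t : Fin n → P),
    (∀ j, t j ∈ I) → Structure.RelMap R (fun j => π (t j)) → Structure.RelMap R t

/-- The range of an embedding of an irreducible structure is irreducible. -/
theorem irrSet_range {L : FirstOrder.Language.{0, 0}} {G P : Type} [L.Structure G] [L.Structure P]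
    (hG : Irred L G) (φ : G ↪[L] P) : IrrSet L (Set.range φ) := by
  rintro _ ⟨u, rfl⟩ _ ⟨v, rfl⟩
  obtain ⟨n, R, t, ht, ⟨a, ha⟩, ⟨b, hb⟩⟩ := hG u v
  exact ⟨n, R, fun j => φ (t j), (emb_rel φ R t).2 ht, fun j => ⟨_, rfl⟩, ⟨a, by simp [ha]⟩,
    ⟨b, by simp [hb]⟩⟩

/-- Restricting an embedding along another embedding containing its range. -/
theorem emb_factor {L : FirstOrder.Language.{0, 0}} [L.IsRelational] {G P Q : Type}
    [L.Structure G] [L.Structure P] [L.Structure Q] (φ : G ↪[L] Q) (g : P ↪[L] Q)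
    (h : ∀ x, ∃ p, g p = φ x) : Nonempty (G ↪[L] P) := by
  choose f hf using h
  refine ⟨mkEmb f (fun x y hxy => φ.injective (by rw [← hf, ← hf, hxy])) fun n R t => ?_⟩
  rw [← emb_rel g, ← emb_rel φ]
  simp only [hf]

/-- If `π ∘ φ` factors through an embedding `S`, then the irreducible `G` embeds in `A`. -/
theorem emb_of_homEmb {L : FirstOrder.Language.{0, 0}} [L.IsRelational] {G P X A : Type}
    [L.Structure G] [L.Structure P] [L.Structure X] [L.Structure A] (hG : Irred L G)
    (φ : G ↪[L] P) {π : P → X} (hπ : HomEmb L π) (S : A → X)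
    (hS : ∀ (n : ℕ) (R : L.Relations n) (t : Fin n → A),
      Structure.RelMap R (fun j => S (t j)) ↔ Structure.RelMap R t)
    (h : ∀ x, ∃ a, S a = π (φ x)) : Nonempty (G ↪[L] A) := by
  choose f hf using h
  refine ⟨mkEmb f (fun x y hxy => ?_) fun n R t => ?_⟩
  · obtain ⟨n, R, t, ht, ⟨a, ha⟩, ⟨b, hb⟩⟩ := hG x y
    have := hπ.inj n R _ ((emb_rel φ R t).2 ht) a b (by rw [← hf, ← hf, ha, hb, hxy])
    rw [← ha, ← hb]
    exact φ.injective this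
  · rw [← hS]
    simp only [hf]
    rw [← emb_rel φ]
    constructor
    · exact hπ.refl _ (irrSet_range hG φ) n R _ (fun j => ⟨_, rfl⟩)
    · exact hπ.hom n R _

section Step

variable {L : FirstOrder.Language.{0, 0}} {A P X : Type} [L.Structure A]
  [L.Structure P]

/-- Copies of `A` in `P` over `S`. -/
abbrev Cop (L : FirstOrder.Language.{0, 0}) {A P X : Type} [L.Structure A]
    [L.Structure P] (S : A → X) (π : P → X) : Type :=
  {e : A ↪[L] P // ∀ x, π (e x) = S x}

/-- Vertices of the next partite system. -/
abbrev NextV (L : FirstOrder.Language.{0, 0}) {A P X : Type} [L.Structure A]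
    [L.Structure P] (S : A → X) (π : P → X) (ι : Type) : Type :=
  (A × (ι → P)) ⊕ (Line (Cop L S π) ι × P)

/-- The point of the power determined by a line. -/
def lpt {S : A → X} {π : P → X} {ι : Type} (l : Line (Cop L S π) ι) (x : A) (p : P) : ι → P :=
  fun i => (l.idxFun i).elim p (fun a => a.1 x)

theorem lpt_none {S : A → X} {π : P → X} {ι : Type} {l : Line (Cop L S π) ι} {i : ι}
    (h : l.idxFun i = none) (x : A) (p : P) : lpt l x p i = p := by simp [lpt, h]

theorem lpt_some {S : A → X} {π : P → X} {ι : Type} {l : Line (Cop L S π) ι} {i : ι}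
    {a : Cop L S π} (h : l.idxFun i = some a) (x : A) (p : P) : lpt l x p i = a.1 x := by
  simp [lpt, h]

open Classical in
/-- The copy of `P` given by a line. -/
noncomputable def gmap {S : A → X} {π : P → X} {ι : Type} (l : Line (Cop L S π) ι) (p : P) :
    NextV L S π ι :=
  if h : ∃ x, S x = π p then Sum.inl (h.choose, lpt l h.choose p) else Sum.inr (l, p)

theorem gmap_in {S : A → X} (hS : Function.Injective S) {π : P → X} {ι : Type}
    (l : Line (Cop L S π) ι) {p : P} {x : A} (h : S x = π p) :
    gmap l p = Sum.inl (x, lpt l x p) := by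
  have h' : ∃ x, S x = π p := ⟨x, h⟩
  have : h'.choose = x := hS (h'.choose_spec.trans h.symm)
  rw [gmap, dif_pos h', this]

theorem gmap_out {S : A → X} {π : P → X} {ι : Type}
    (l : Line (Cop L S π) ι) {p : P} (h : ¬ ∃ x, S x = π p) :
    gmap l p = Sum.inr (l, p) := by
  rw [gmap, dif_neg h]

theorem gmap_eq_inl {S : A → X} (hS : Function.Injective S) {π : P → X} {ι : Type}
    {l : Line (Cop L S π) ι} {p : P} {x : A} {f : ι → P} (h : gmap l p = Sum.inl (x, f)) :
    S x = π p ∧ f = lpt l x p := by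
  by_cases hp : ∃ x, S x = π p
  · obtain ⟨y, hy⟩ := hp
    rw [gmap_in hS l hy] at h
    simp only [Sum.inl.injEq, Prod.mk.injEq] at h
    obtain ⟨rfl, rfl⟩ := h
    exact ⟨hy, rfl⟩
  · rw [gmap_out l hp] at h
    simp at h

theorem gmap_eq_inr {S : A → X} (hS : Function.Injective S) {π : P → X} {ι : Type}
    {l l' : Line (Cop L S π) ι} {p p' : P} (h : gmap l p = Sum.inr (l', p')) :
    l = l' ∧ p = p' := by
  by_cases hp : ∃ x, S x = π p
  · obtain ⟨y, hy⟩ := hp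
    rw [gmap_in hS l hy] at h
    simp at h
  · rw [gmap_out l hp] at h
    simpa using h

theorem gmap_inj {S : A → X} (hS : Function.Injective S) {π : P → X} {ι : Type}
    (l : Line (Cop L S π) ι) : Function.Injective (gmap l) := by
  intro p q h
  rcases hq : gmap l q with ⟨x, f⟩ | ⟨l', p'⟩
  · obtain ⟨_, h1⟩ := gmap_eq_inl hS (h.trans hq)
    obtain ⟨_, h2⟩ := gmap_eq_inl hS hq
    obtain ⟨i, hi⟩ := l.proper
    have := congrFun (h1.symm.trans h2) i
    rwa [lpt_none hi, lpt_none hi] at this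
  · rw [(gmap_eq_inr hS (h.trans hq)).2, (gmap_eq_inr hS hq).2]

/-- The projection of the next partite system. -/
def nextπ {S : A → X} {π : P → X} {ι : Type} : NextV L S π ι → X
  | Sum.inl (x, _) => S x
  | Sum.inr (_, p) => π p

theorem nextπ_gmap {S : A → X} (hS : Function.Injective S) {π : P → X} {ι : Type}
    (l : Line (Cop L S π) ι) (p : P) : nextπ (gmap l p) = π p := by
  by_cases hp : ∃ x, S x = π p
  · obtain ⟨y, hy⟩ := hp
    rw [gmap_in hS l hy]
    exact hy
  · rw [gmap_out l hp]
    rfl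

/-- The relations of the next partite system. -/
def nextRel {S : A → X} {π : P → X} {ι : Type} (n : ℕ) (R : L.Relations n)
    (t : Fin n → NextV L S π ι) : Prop :=
  (∃ (l : Line (Cop L S π) ι) (v : Fin n → P), Structure.RelMap R v ∧ ∀ j, t j = gmap l (v j)) ∨
  (∃ (s : Fin n → A) (f : Fin n → ι → P), Structure.RelMap R s ∧
    (∀ i, Structure.RelMap R (fun j => f j i)) ∧ (∀ i j, π (f j i) = S (s j)) ∧
    ∀ j, t j = Sum.inl (s j, f j))

theorem nextRel_gmap {S : A → X} (hS : Function.Injective S) {π : P → X} {ι : Type} {n : ℕ}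
    (R : L.Relations n) (l : Line (Cop L S π) ι) (v : Fin n → P) :
    nextRel n R (fun j => gmap l (v j)) ↔ Structure.RelMap R v := by
  constructor
  · rintro (⟨l', v', hv', h⟩ | ⟨s, f, hs, hf, hπ, h⟩)
    · by_cases hD : ∀ j, ∃ x, S x = π (v j)
      · choose x hx using hD
        have hl : ∀ j, gmap l (v j) = Sum.inl (x j, lpt l (x j) (v j)) :=
          fun j => gmap_in hS l (hx j)
        have hl' : ∀ j, lpt l (x j) (v j) = lpt l' (x j) (v' j) := fun j =>
          (gmap_eq_inl hS ((h j).symm.trans (hl j))).2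
        obtain ⟨i, hi⟩ := l.proper
        obtain ⟨i', hi'⟩ := l'.proper
        rcases h1 : l'.idxFun i with _ | a
        · have : v = v' := by
            funext j
            have := congrFun (hl' j) i
            rwa [lpt_none hi, lpt_none h1] at this
          rwa [this]
        · have hv : v = fun j => a.1 (x j) := by
            funext j
            have := congrFun (hl' j) i
            rwa [lpt_none hi, lpt_some h1] at this
          rw [hv, emb_rel]
          rcases h2 : l.idxFun i' with _ | a'
          · have : v = v' := by
              funext j
              have := congrFun (hl' j) i'
              rwa [lpt_none hi', lpt_none h2] at this
            rw [← this, hv, emb_rel] at hv'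
            exact hv'
          · have : v' = fun j => a'.1 (x j) := by
              funext j
              have := congrFun (hl' j) i'
              rw [lpt_none hi', lpt_some h2] at this
              exact this.symm
            rw [this, emb_rel] at hv'
            exact hv'
      · push Not at hD
        obtain ⟨j, hj⟩ := hD
        have h1 := h j
        simp only at h1
        rw [gmap_out l (by push Not; exact hj)] at h1
        obtain rfl := (gmap_eq_inr hS h1.symm).1
        have : v = v' := funext fun j => gmap_inj hS _ (h j)
        rwa [this]
    · obtain ⟨i, hi⟩ := l.proper
      have : v = fun j => f j i := by
        funext j
        rw [(gmap_eq_inl hS (h j)).2, lpt_none hi]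
      rw [this]
      exact hf i
  · intro h
    exact Or.inl ⟨l, v, h, fun j => rfl⟩

theorem nextRel_point {S : A → X} (hS : Function.Injective S) {π : P → X} {ι : Type} {n : ℕ}
    (R : L.Relations n) (w : ι → Cop L S π) (s : Fin n → A) :
    nextRel (S := S) (π := π) n R (fun j => Sum.inl (s j, fun i => (w i).1 (s j))) ↔
      Structure.RelMap R s := by
  constructor
  · rintro (⟨l, v, hv, h⟩ | ⟨s', f, hs, hf, hπ, h⟩)
    · obtain ⟨i, hi⟩ := l.proper
      have : v = fun j => (w i).1 (s j) := by
        funext j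
        have := congrFun (gmap_eq_inl hS (h j).symm).2 i
        rw [lpt_none hi] at this
        exact this.symm
      rwa [this, emb_rel] at hv
    · have : s = s' := by
        funext j
        have := h j
        simp only [Sum.inl.injEq, Prod.mk.injEq] at this
        exact this.1
      rwa [this]
  · intro h
    exact Or.inr ⟨s, fun j i => (w i).1 (s j), h, fun i => (emb_rel _ R s).2 h,
      fun i j => (w i).2 _, fun j => rfl⟩

/-- An irreducible set of the next system lies in the power part or in a copy of `P`. -/
theorem irr_cases {S : A → X} (hS : Function.Injective S) {π : P → X} {ι : Type}
    (I : Set (NextV L S π ι))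
    (hI : ∀ u ∈ I, ∀ v ∈ I, ∃ (n : ℕ) (R : L.Relations n) (t : Fin n → NextV L S π ι),
      nextRel n R t ∧ (∀ j, t j ∈ I) ∧ (∃ a, t a = u) ∧ (∃ b, t b = v)) :
    (∀ u ∈ I, ∃ x f, u = Sum.inl (x, f)) ∨
      ∃ l : Line (Cop L S π) ι, ∀ u ∈ I, ∃ p, gmap l p = u := by
  by_cases h : ∀ u ∈ I, ∃ x f, u = Sum.inl (x, f)
  · exact Or.inl h
  · push Not at h
    obtain ⟨u, hu, hne⟩ := h
    rcases u with ⟨x, f⟩ | ⟨l, p⟩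
    · exact absurd rfl (hne x f)
    · refine Or.inr ⟨l, fun v hv => ?_⟩
      obtain ⟨n, R, t, ht, -, ⟨a, ha⟩, ⟨b, hb⟩⟩ := hI _ hu v hv
      rcases ht with ⟨l', v', hv', h⟩ | ⟨s, f, hs, hf, hπ, h⟩
      · have := h a
        rw [ha] at this
        obtain rfl := (gmap_eq_inr hS this.symm).1
        exact ⟨v' b, by rw [← h, hb]⟩
      · have := h a
        rw [ha] at this
        simp at this

theorem nextHomEmb [L.IsRelational] [L.Structure X] {S : A → X} (hS : Function.Injective S)
    {π : P → X} {ι : Type}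
    (hSr : ∀ (n : ℕ) (R : L.Relations n) (t : Fin n → A),
      Structure.RelMap R (fun j => S (t j)) ↔ Structure.RelMap R t)
    (hπ : HomEmb L π) :
    @HomEmb L (NextV L S π ι) X (mkStr L _ nextRel) _ nextπ := by
  letI : L.Structure (NextV L S π ι) := mkStr L _ nextRel
  refine ⟨?_, ?_, ?_⟩
  · rintro n R t (⟨l, v, hv, h⟩ | ⟨s, f, hs, hf, hfs, h⟩)
    · simp only [h, nextπ_gmap hS]
      exact hπ.hom n R v hv
    · simp only [h, nextπ]
      exact (hSr n R s).2 hs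
  · rintro n R t (⟨l, v, hv, h⟩ | ⟨s, f, hs, hf, hfs, h⟩) i j hij
    · simp only [h, nextπ_gmap hS] at hij
      rw [h, h, hπ.inj n R v hv i j hij]
    · simp only [h, nextπ] at hij
      have h1 : f i = f j := by
        funext c
        exact hπ.inj n R _ (hf c) i j (by rw [hfs, hfs, hij])
      rw [h, h, hS hij, h1]
  · intro I hI n R t htI ht
    rcases irr_cases hS I hI with hinl | ⟨l, hl⟩
    · -- coordinates of a related tuple in the power part
      have hco : ∀ (n : ℕ) (R : L.Relations n) (x : Fin n → A) (f : Fin n → ι → P),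
          nextRel (S := S) (π := π) n R (fun j => Sum.inl (x j, f j)) →
          ∀ i, Structure.RelMap R (fun j => f j i) ∧ ∀ j, π (f j i) = S (x j) := by
        rintro n R x f (⟨l, v, hv, h⟩ | ⟨s, f', hs, hf, hfs, h⟩) i
        · have h1 := fun j => (gmap_eq_inl hS (h j).symm).1
          have h2 := fun j => (gmap_eq_inl hS (h j).symm).2
          rcases hi : l.idxFun i with _ | a
          · simp only [h2, lpt_none hi]
            exact ⟨hv, fun j => (h1 j).symm⟩
          · simp only [h2, lpt_some hi]
            refine ⟨?_, fun j => a.2 _⟩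
            rw [emb_rel, ← hSr]
            simp only [h1]
            exact hπ.hom n R v hv
        · simp only [Sum.inl.injEq, Prod.mk.injEq] at h
          simp only [(h _).1, (h _).2]
          exact ⟨hf i, fun j => hfs i j⟩
      have hval : ∀ x f, (Sum.inl (x, f) : NextV L S π ι) ∈ I → ∀ i, π (f i) = S x := by
        intro x f hxf i
        obtain ⟨m, Q, u, hu, huI, ⟨a, ha⟩, -⟩ := hI _ hxf _ hxf
        choose y g hyg using fun j => hinl _ (huI j)
        obtain rfl : u = _ := funext hyg
        have := (hco m Q y g hu i).2 a
        simp only [Sum.inl.injEq, Prod.mk.injEq] at ha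
        rwa [ha.1, ha.2] at this
      choose x f hxf using fun j => hinl _ (htI j)
      obtain rfl : t = _ := funext hxf
      simp only [nextπ] at ht
      refine Or.inr ⟨x, f, (hSr n R x).1 ht, fun i => ?_, fun i j => hval _ _ (htI j) i,
        fun j => rfl⟩
      refine hπ.refl {p | ∃ x f, (Sum.inl (x, f) : NextV L S π ι) ∈ I ∧ f i = p} ?_ n R _
        (fun j => ⟨_, _, htI j, rfl⟩) ?_
      · rintro _ ⟨x1, f1, h1, rfl⟩ _ ⟨x2, f2, h2, rfl⟩
        obtain ⟨m, Q, u, hu, huI, ⟨a, ha⟩, ⟨b, hb⟩⟩ := hI _ h1 _ h2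
        choose y g hyg using fun j => hinl _ (huI j)
        obtain rfl : u = _ := funext hyg
        simp only [Sum.inl.injEq, Prod.mk.injEq] at ha hb
        exact ⟨m, Q, fun j => g j i, (hco m Q y g hu i).1, fun j => ⟨_, _, huI j, rfl⟩,
          ⟨a, congrFun ha.2 i⟩, ⟨b, congrFun hb.2 i⟩⟩
      · have : ∀ j, π (f j i) = S (x j) := fun j => hval _ _ (htI j) i
        simp only [this]
        exact ht
    · choose v hv using fun j => hl _ (htI j)
      obtain rfl : _ = t := funext hv
      refine (nextRel_gmap hS R l v).2 ?_
      simp only [nextπ_gmap hS] at ht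
      refine hπ.refl {p | gmap l p ∈ I} ?_ n R v htI ht
      intro p hp q hq
      obtain ⟨m, Q, u, hu, huI, ⟨a, ha⟩, ⟨b, hb⟩⟩ := hI _ hp _ hq
      choose w hw using fun j => hl _ (huI j)
      obtain rfl : _ = u := funext hw
      exact ⟨m, Q, w, (nextRel_gmap hS Q l w).1 hu, huI, ⟨a, gmap_inj hS l ha⟩,
        ⟨b, gmap_inj hS l hb⟩⟩

theorem finite_emb [Finite A] [Finite P] : Finite (A ↪[L] P) :=
  Finite.of_injective (fun e : A ↪[L] P => (e : A → P)) DFunLike.coe_injective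

end Step

/-- One step of the partite construction. -/
theorem partite_step {L : FirstOrder.Language.{0, 0}} [L.IsRelational] {A P X : Type}
    [L.Structure A] [L.Structure P] [Finite A] [Finite P] (k : ℕ) (S : A → X)
    (hS : Function.Injective S) (π : P → X) :
    ∃ (Q : Type) (_ : L.Structure Q) (π' : Q → X), Finite Q ∧
      (∀ χ : (A ↪[L] Q) → Fin k, ∃ g : P ↪[L] Q, (∀ p, π' (g p) = π p) ∧
        ∀ e e' : A ↪[L] P, (∀ x, π (e x) = S x) → (∀ x, π (e' x) = S x) →
          χ (g.comp e) = χ (g.comp e')) ∧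
      ∀ [L.Structure X], (∀ (n : ℕ) (R : L.Relations n) (t : Fin n → A),
          Structure.RelMap R (fun j => S (t j)) ↔ Structure.RelMap R t) → HomEmb L π →
        HomEmb L π' ∧ ∀ (G : Type) [L.Structure G], Irred L G → Nonempty (G ↪[L] Q) →
          Nonempty (G ↪[L] P) ∨ Nonempty (G ↪[L] A) := by
  have : Finite (A ↪[L] P) := finite_emb
  obtain ⟨ι, hι, hHJ⟩ := Line.exists_mono_in_high_dimension (Cop L S π) (Fin k)
  letI : L.Structure (NextV L S π ι) := mkStr L _ nextRel
  have hLine : Finite (Line (Cop L S π) ι) := by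
    refine Finite.of_injective (fun l : Line (Cop L S π) ι => l.idxFun) ?_
    rintro ⟨f, hf⟩ ⟨g, hg⟩ h
    simp only at h
    subst h
    rfl
  let gE : ∀ l : Line (Cop L S π) ι, P ↪[L] NextV L S π ι := fun l =>
    mkEmb (gmap l) (gmap_inj hS l) (fun n R v => nextRel_gmap hS R l v)
  refine ⟨NextV L S π ι, inferInstance, nextπ, inferInstance, ?_, ?_⟩
  · intro χ
    let wE : ∀ w : ι → Cop L S π, A ↪[L] NextV L S π ι := fun w =>
      mkEmb (fun x => Sum.inl (x, fun i => (w i).1 x)) (fun x y h => by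
        simp only [Sum.inl.injEq, Prod.mk.injEq] at h
        exact h.1) (fun n R s => nextRel_point hS R w s)
    obtain ⟨l, c, hc⟩ := hHJ (fun w => χ (wE w))
    have key : ∀ e : A ↪[L] P, (∀ x, π (e x) = S x) → χ ((gE l).comp e) = c := by
      intro e he
      rw [← hc ⟨e, he⟩]
      congr 1
      ext x
      change gmap l (e x) = Sum.inl (x, fun i => (l ⟨e, he⟩ i).1 x)
      rw [gmap_in hS l (he x).symm]
      congr 2
      funext i
      rcases hi : l.idxFun i with _ | a
      · rw [lpt_none hi, l.apply_none _ _ hi]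
      · rw [lpt_some hi, Line.apply_some hi]
    exact ⟨gE l, fun p => nextπ_gmap hS l p, fun e e' he he' => (key e he).trans (key e' he').symm⟩
  · intro _ hSr hπ
    have hH := nextHomEmb (ι := ι) hS hSr hπ
    refine ⟨hH, fun G _ hG ⟨φ⟩ => ?_⟩
    rcases irr_cases hS _ (irrSet_range hG φ) with hinl | ⟨l, hl⟩
    · right
      refine emb_of_homEmb hG φ hH S hSr fun x => ?_
      obtain ⟨a, f, h⟩ := hinl _ ⟨x, rfl⟩
      exact ⟨a, by rw [h]; rfl⟩
    · left
      exact emb_factor φ (gE l) fun x => hl _ ⟨x, rfl⟩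

/-- Iterating the partite construction over a list. -/
theorem partite_iter {L : FirstOrder.Language.{0, 0}} [L.IsRelational] {A P X : Type}
    [L.Structure A] [L.Structure P] [Finite A] [Finite P] (k : ℕ) (π : P → X) (Ss : List (A → X))
    (hS : ∀ S ∈ Ss, Function.Injective S) :
    ∃ (Q : Type) (_ : L.Structure Q) (π' : Q → X), Finite Q ∧
      (∀ χ : (A ↪[L] Q) → Fin k, ∃ g : P ↪[L] Q, (∀ p, π' (g p) = π p) ∧ ∀ S ∈ Ss,
        ∀ e e' : A ↪[L] P, (∀ x, π (e x) = S x) → (∀ x, π (e' x) = S x) →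
          χ (g.comp e) = χ (g.comp e')) ∧
      ∀ [L.Structure X], (∀ S ∈ Ss, ∀ (n : ℕ) (R : L.Relations n) (t : Fin n → A),
          Structure.RelMap R (fun j => S (t j)) ↔ Structure.RelMap R t) → HomEmb L π →
        HomEmb L π' ∧ ∀ (G : Type) [L.Structure G], Irred L G → Nonempty (G ↪[L] Q) →
          Nonempty (G ↪[L] P) ∨ Nonempty (G ↪[L] A) := by
  induction Ss with
  | nil =>
    refine ⟨P, inferInstance, π, inferInstance, fun χ => ⟨Embedding.refl L P, fun p => rfl, ?_⟩, ?_⟩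
    · simp
    · intro _ _ h
      exact ⟨h, fun G _ _ hG => Or.inl hG⟩
  | cons S Ss ih =>
    obtain ⟨Q, _, π₁, _, h1, h2⟩ := ih (fun T hT => hS T (List.mem_cons_of_mem _ hT))
    obtain ⟨Q', _, π₂, _, h3, h4⟩ := partite_step (L := L) k S (hS S List.mem_cons_self) π₁
    refine ⟨Q', inferInstance, π₂, inferInstance, fun χ => ?_, ?_⟩
    · obtain ⟨g2, hg2, hc2⟩ := h3 χ
      obtain ⟨g1, hg1, hc1⟩ := h1 (fun e => χ (g2.comp e))
      refine ⟨g2.comp g1, fun p => by simp [hg1, hg2], fun T hT e e' he he' => ?_⟩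
      rcases List.mem_cons.1 hT with rfl | hT
      · exact hc2 (g1.comp e) (g1.comp e') (fun x => by simp [hg1, he])
          (fun x => by simp [hg1, he'])
      · exact hc1 T hT e e' he he'
    · intro _ hr hπ
      obtain ⟨hπ₁, hG1⟩ := h2 (fun T hT => hr T (List.mem_cons_of_mem _ hT)) hπ
      obtain ⟨hπ₂, hG2⟩ := h4 (hr S List.mem_cons_self) hπ₁
      refine ⟨hπ₂, fun G _ hG hE => ?_⟩
      rcases hG2 G hG hE with h | h
      · exact hG1 G hG h
      · exact Or.inr h

/-- Partite construction starting with the disjoint union of copies of `B`. -/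
theorem partite_full {L : FirstOrder.Language.{0, 0}} [L.IsRelational] {A B X J : Type}
    [L.Structure A] [L.Structure B] [Finite A] [Finite B] [Finite J] (k : ℕ) (hk : 1 ≤ k)
    (β : J → B → X) (𝒮 : Set (A → X)) (h𝒮 : 𝒮.Finite) (hS : ∀ S ∈ 𝒮, Function.Injective S) :
    ∃ (Q : Type) (_ : L.Structure Q), Finite Q ∧
      (∀ χ : (A ↪[L] Q) → Fin k, ∃ (c : (A → X) → Fin k) (g : J → (B ↪[L] Q)), ∀ (j : J)
        (e : A ↪[L] B), (fun x => β j (e x)) ∈ 𝒮 → χ ((g j).comp e) = c (fun x => β j (e x))) ∧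
      ∀ [L.Structure X], Nonempty J → (∀ j, Function.Injective (β j)) →
        (∀ S ∈ 𝒮, ∀ (n : ℕ) (R : L.Relations n) (t : Fin n → A),
          Structure.RelMap R (fun j => S (t j)) ↔ Structure.RelMap R t) →
        (∀ j, ∀ (n : ℕ) (R : L.Relations n) (t : Fin n → B),
          Structure.RelMap R (fun i => β j (t i)) ↔ Structure.RelMap R t) →
        ∀ (G : Type) [L.Structure G], Irred L G → Nonempty (G ↪[L] Q) →
          Nonempty (G ↪[L] B) ∨ Nonempty (G ↪[L] A) := by
  letI : L.Structure (J × B) := mkStr L _ (fun n R t =>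
    ∃ (j : J) (v : Fin n → B), Structure.RelMap R v ∧ ∀ i, t i = (j, v i))
  let bE : ∀ j : J, B ↪[L] (J × B) := fun j => mkEmb (fun b => (j, b))
    (fun x y h => by simpa using h) (fun n R t => by
      constructor
      · rintro ⟨j', v, hv, h⟩
        have : t = v := funext fun i => by
          have := h i
          simp only [Prod.mk.injEq] at this
          exact this.2
        rwa [this]
      · intro h
        exact ⟨j, t, h, fun i => rfl⟩)
  obtain ⟨Q, _, π', hQ, h1, h2⟩ := partite_iter (L := L) (A := A) k
    (fun p : J × B => β p.1 p.2) h𝒮.toFinset.toList (by simpa using hS)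
  refine ⟨Q, inferInstance, hQ, fun χ => ?_, ?_⟩
  · obtain ⟨g, -, hg⟩ := h1 χ
    classical
    refine ⟨fun S => if h : ∃ e : A ↪[L] (J × B), ∀ x, β (e x).1 (e x).2 = S x then
      χ (g.comp h.choose) else ⟨0, hk⟩, fun j => g.comp (bE j), fun j e he => ?_⟩
    have h : ∃ e' : A ↪[L] (J × B), ∀ x, β (e' x).1 (e' x).2 = β j (e x) :=
      ⟨(bE j).comp e, fun x => rfl⟩
    refine Eq.trans ?_ (dif_pos h).symm
    exact hg (fun x => β j (e x)) (by simpa using he) ((bE j).comp e) h.choose (fun x => rfl) h.choose_spec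
  · intro _ ⟨j0⟩ hinj hSr hBr G _ hG hGQ
    have hcase : ∀ I : Set (J × B), IrrSet L I → ∃ j, ∀ u ∈ I, ∃ b, u = (j, b) := by
      intro I hI
      rcases I.eq_empty_or_nonempty with rfl | ⟨u, hu⟩
      · exact ⟨j0, by simp⟩
      · refine ⟨u.1, fun w hw => ⟨w.2, ?_⟩⟩
        obtain ⟨n, R, t, ⟨j, v, hv, h⟩, -, ⟨a, ha⟩, ⟨b, hb⟩⟩ := hI u hu w hw
        rw [← ha, ← hb, h, h]
    have hHE : HomEmb L (fun p : J × B => β p.1 p.2) := by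
      refine ⟨?_, ?_, ?_⟩
      · rintro n R t ⟨j, v, hv, h⟩
        simp only [h]
        exact (hBr j n R v).2 hv
      · rintro n R t ⟨j, v, hv, h⟩ a b hab
        simp only [h] at hab
        rw [h, h, hinj j hab]
      · intro I hI n R t htI ht
        obtain ⟨j, hj⟩ := hcase I hI
        choose v hv using fun i => hj _ (htI i)
        simp only [hv] at ht
        exact ⟨j, v, (hBr j n R v).1 ht, hv⟩
    rcases (h2 (by simpa using hSr) hHE).2 G hG hGQ with ⟨⟨φ⟩⟩ | h
    · left
      obtain ⟨j, hj⟩ := hcase _ (irrSet_range hG φ)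
      refine emb_factor φ (bE j) fun x => ?_
      obtain ⟨b, hb⟩ := hj _ ⟨x, rfl⟩
      exact ⟨b, hb.symm⟩
    · exact Or.inr h

/-- The Ramsey degree statement without forbidden structures. -/
theorem ramsey_degree {L : FirstOrder.Language.{0, 0}} [L.IsRelational] (A B : Type)
    [L.Structure A] [L.Structure B] [Finite A] [Finite B] (k : ℕ) (hk : 1 ≤ k) :
    ∃ (Q : Type) (_ : L.Structure Q), Finite Q ∧
      Arrow L Q B A k (Nat.card (A ≃ Fin (Nat.card A))) := by
  classical
  have : NeZero k := ⟨by omega⟩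
  obtain ⟨N, hN⟩ := ramsey_fin (α := ℕ) (Nat.card A) ((A ≃ Fin (Nat.card A)) → Fin k) (Nat.card B)
  have := Fintype.ofFinite A
  have := Fintype.ofFinite B
  have hfin : (Set.range fun (s : A ↪ Fin N) (x : A) => ((s x : Fin N) : ℕ)).Finite :=
    Set.finite_range _
  obtain ⟨Q, _, hQ, hc, -⟩ := partite_full (L := L) (A := A) (B := B) k hk
    (fun (s : B ↪ Fin N) (x : B) => ((s x : Fin N) : ℕ)) _ hfin (by
      rintro _ ⟨s, rfl⟩ x y h
      exact s.injective (Fin.ext h))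
  refine ⟨Q, inferInstance, hQ, fun χ => ?_⟩
  obtain ⟨c, g, hg⟩ := hc χ
  obtain ⟨H, hH, hHc, κ, hκ⟩ := hN (Finset.range N) (by simp) (fun s σ =>
    if h : s.card = Nat.card A then c (fun x => s.orderEmbOfFin h (σ x)) else 0)
  -- the injection with image `H`
  let eB : B ≃ H := Fintype.equivOfCardEq (by simp [hHc])
  let s : B ↪ Fin N := ⟨fun b => ⟨(eB b : ℕ), by simpa using hH (eB b).2⟩, fun x y h => by
    simp only [Fin.mk.injEq] at h
    exact eB.injective (Subtype.ext h)⟩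
  refine ⟨g s, ?_⟩
  have hsub : {col : Fin k | ∃ e : A ↪[L] Q, Set.range ⇑e ⊆ Set.range ⇑(g s) ∧ χ e = col} ⊆
      Set.range κ := by
    rintro _ ⟨e, he, rfl⟩
    have he' : ∀ x, ∃ b, g s b = e x := fun x => he ⟨x, rfl⟩
    choose f hf using he'
    let e' : A ↪[L] B := mkEmb f (fun x y hxy => e.injective (by rw [← hf, ← hf, hxy]))
      (fun n R t => by rw [← emb_rel (g s), ← emb_rel e]; simp only [hf])
    have hee : e = (g s).comp e' := by
      ext x
      exact (hf x).symm
    have hcol := hg s e' ⟨⟨fun x => s (e' x), fun x y h => e'.injective (s.injective h)⟩, rfl⟩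
    let m : A → ℕ := fun x => ((s (e' x) : Fin N) : ℕ)
    have hm : Function.Injective m := fun x y h => e'.injective (s.injective (Fin.ext h))
    let T : Finset ℕ := Finset.univ.image m
    have hT : T.card = Nat.card A := by
      rw [Finset.card_image_of_injective _ hm, Finset.card_univ, Nat.card_eq_fintype_card]
    have hTH : T ⊆ H := by
      intro z hz
      obtain ⟨x, -, rfl⟩ := Finset.mem_image.1 hz
      exact (eB (e' x)).2
    let mT : A ≃ T := Equiv.ofBijective (fun x => ⟨m x, Finset.mem_image_of_mem _ (Finset.mem_univ _)⟩)
      ⟨fun x y h => hm (by simpa using h), fun ⟨z, hz⟩ => by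
        obtain ⟨x, -, hx⟩ := Finset.mem_image.1 hz
        exact ⟨x, Subtype.ext hx⟩⟩
    let σ : A ≃ Fin (Nat.card A) := mT.trans (T.orderIsoOfFin hT).symm.toEquiv
    have hσ : ∀ x, T.orderEmbOfFin hT (σ x) = m x := by
      intro x
      rw [← Finset.coe_orderIsoOfFin_apply]
      simp only [σ, Equiv.trans_apply]
      erw [OrderIso.apply_symm_apply]
      rfl
    refine ⟨σ, ?_⟩
    have h1 := congrFun (hκ T hTH hT) σ
    simp only [dif_pos hT, hσ] at h1
    rw [hee, hcol, ← h1]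
  calc _ ≤ (Set.range κ).ncard := Set.ncard_le_ncard hsub (Set.toFinite _)
    _ ≤ _ := by
      rw [← Set.image_univ]
      exact (Set.ncard_image_le (Set.toFinite _)).trans (Set.ncard_univ _).le

end PartiteConstruction

theorem nesetril_rodl
    (L : FirstOrder.Language.{0, 0}) [L.IsRelational]
    (ι : Type) (F : ι → FOStr L)
    (hFfin : ∀ i, Finite (F i).carrier) (hFirr : ∀ i, Irred L (F i).carrier)
    (A : Type) [L.Structure A] [Finite A] (hAfree : FFree F A) :
    ∃ d : ℕ, ∀ (B : Type) [L.Structure B] [Finite B], FFree F B →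
      ∀ k : ℕ, 1 ≤ k → ∃ C : FOStr L, Finite C.carrier ∧ FFree F C.carrier ∧
        Arrow L C.carrier B A k d := by
  refine ⟨Nat.card (A ≃ Fin (Nat.card A)), fun B _ _ hB k hk => ?_⟩
  obtain ⟨X, _, _, hX⟩ := ramsey_degree (L := L) A B k hk
  have : Finite (A ↪[L] X) := finite_emb
  have : Finite (B ↪[L] X) := finite_emb
  obtain ⟨Q, sQ, hQ, hc, hfree⟩ := partite_full (L := L) (A := A) (B := B) (J := B ↪[L] X) k hk
    (fun β b => β b) (Set.range fun (S : A ↪[L] X) (x : A) => S x) (Set.finite_range _) (by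
      rintro _ ⟨S, rfl⟩
      exact S.injective)
  refine ⟨⟨Q, sQ⟩, hQ, fun i => ?_, fun χ => ?_⟩
  · obtain ⟨β, -⟩ := hX (fun _ => ⟨0, hk⟩)
    rw [← not_nonempty_iff]
    intro hne
    rcases hfree ⟨β⟩ (fun j => j.injective)
      (by
        rintro _ ⟨S, rfl⟩ n R t
        exact emb_rel S R t)
      (fun j n R t => emb_rel j R t) _ (hFirr i) hne with h | h
    · exact not_nonempty_iff.2 (hB i) h
    · exact not_nonempty_iff.2 (hAfree i) h
  · obtain ⟨c, g, hg⟩ := hc χ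
    obtain ⟨β, hβ⟩ := hX (fun e => c (fun x => e x))
    refine ⟨g β, le_trans (Set.ncard_le_ncard ?_ (Set.toFinite _)) hβ⟩
    rintro _ ⟨e, he, rfl⟩
    have he' : ∀ x, ∃ b, g β b = e x := fun x => he ⟨x, rfl⟩
    choose f hf using he'
    let e' : A ↪[L] B := mkEmb f (fun x y hxy => e.injective (by rw [← hf, ← hf, hxy]))
      (fun n R t => by rw [← emb_rel (g β), ← emb_rel e]; simp only [hf])
    have hee : e = (g β).comp e' := by
      ext x
      exact (hf x).symm
    refine ⟨β.comp e', ?_, ?_⟩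
    · rintro _ ⟨x, rfl⟩
      exact ⟨e' x, rfl⟩
    · rw [hee]
      exact (hg β e' ⟨β.comp e', rfl⟩).symm
end

section
/- The linear order (ℚ, ≤) of the rational numbers has finite big Ramsey degrees: for every finite linear order A there exists a finite D = D(A) such that for every k ≥ 1 and every colouring of the set of order-embeddings of A into ℚ with k colours, there exists an order-embedding f: ℚ → ℚ such that the embeddings of A into ℚ whose range lies in f[ℚ] receive at most D colours. -/
namespace BigRamsey

open Filter

/-- Every principal left ideal contains an idempotent lying in a minimal left ideal. -/
theorem exists_minimal {T : Type*} [Semigroup T] [TopologicalSpace T] [CompactSpace T] [T2Space T]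
    (hc : ∀ r : T, Continuous (· * r)) (x : T) :
    ∃ z s : T, z = s * x ∧ z * z = z ∧ ∀ s : T, ∃ r : T, r * (s * z) = z := by
  let S : Set (Set T) := {N | IsClosed N ∧ N.Nonempty ∧ ∀ s : T, ∀ m ∈ N, s * m ∈ N}
  have hprin : ∀ y : T, Set.range (· * y) ∈ S := by
    intro y
    refine ⟨(isCompact_range (hc y)).isClosed, ⟨_, ⟨y, rfl⟩⟩, ?_⟩
    rintro s _ ⟨m, rfl⟩
    exact ⟨s * m, by simp [mul_assoc]⟩
  obtain ⟨N, hNx, hN⟩ := zorn_superset_nonempty S (by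
    intro c hcS hch hne
    refine ⟨⋂₀ c, ⟨isClosed_sInter fun t ht => (hcS ht).1, ?_, ?_⟩,
      fun s hs => Set.sInter_subset_of_mem hs⟩
    · have := hne.to_subtype
      refine IsCompact.nonempty_sInter_of_directed_nonempty_isCompact_isClosed ?_
        (fun U hU => (hcS hU).2.1) (fun U hU => (hcS hU).1.isCompact) (fun U hU => (hcS hU).1)
      intro a ha b hb
      rcases hch.total ha hb with h | h
      · exact ⟨a, ha, subset_rfl, h⟩
      · exact ⟨b, hb, h, subset_rfl⟩
    · intro s m hm t ht
      exact (hcS ht).2.2 s m (hm t ht)) _ (hprin x)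
  obtain ⟨hNc, hNn, hNl⟩ := hN.prop
  obtain ⟨z, hzN, hzz⟩ := exists_idempotent_in_compact_subsemigroup hc N hNn hNc.isCompact
    (fun a _ b hb => hNl a b hb)
  obtain ⟨s, hs⟩ := hNx hzN
  refine ⟨z, s, hs.symm, hzz, fun s => ?_⟩
  have hsub : Set.range (· * (s * z)) ⊆ N := by
    rintro _ ⟨r, rfl⟩
    exact hNl _ _ (hNl _ _ hzN)
  have := hN.le_of_le (hprin (s * z)) hsub hzN
  obtain ⟨r, hr⟩ := this
  exact ⟨r, hr⟩

theorem exists_absorbing {T₁ T₂ Sg : Type*} [Semigroup T₁] [TopologicalSpace T₁] [CompactSpace T₁]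
    [T2Space T₁] [Nonempty T₁] [Semigroup T₂] [TopologicalSpace T₂] [CompactSpace T₂] [T2Space T₂]
    (hc₁ : ∀ r : T₁, Continuous (· * r)) (hc₂ : ∀ r : T₂, Continuous (· * r))
    (i : T₁ → T₂) (f : Sg → T₂ → T₁)
    (hf : ∀ a x y, f a (x * y) = f a x * f a y)
    (hfi : ∀ a x, f a (i x) = x) (hi : ∀ x y, i (x * y) = i x * i y) (q : T₂) :
    ∃ (u : T₁) (y : T₂), (∀ a, u * f a (q * y) = u) ∧
      ∀ a b, f a (q * y) * f b (q * y) = f a (q * y) := by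
  obtain ⟨u, -, -, huu, hu⟩ := exists_minimal hc₁ (Classical.arbitrary T₁)
  obtain ⟨ε, s, hε, hεε, hmin⟩ := exists_minimal hc₂ (i u)
  have hεu : ε * i u = ε := by rw [hε, mul_assoc, ← hi, huu]
  have hfε : ∀ a, u * f a ε = u := by
    intro a
    obtain ⟨r, hr⟩ := hu (f a s)
    have h1 : f a ε = f a s * u := by rw [hε, hf, hfi]
    rw [← h1] at hr
    calc u * f a ε = r * f a ε * f a ε := by rw [hr]
      _ = r * f a (ε * ε) := by rw [mul_assoc, hf]
      _ = u := by rw [hεε, hr]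
  set v := i u * ε with hv
  have hfv : ∀ a, f a v = u := by intro a; rw [hv, hf, hfi, hfε]
  have hvv : v * v = v := by
    calc v * v = i u * (ε * i u) * ε := by simp only [hv, mul_assoc]
      _ = v := by rw [hεu, mul_assoc, hεε]
  -- left inverses
  have hli : ∀ e, ∃ h, h * v = h ∧ v * h = h ∧ h * (v * e * v) = v := by
    intro e
    obtain ⟨r, hr⟩ := hmin (v * e * i u)
    have h1 : v * e * i u * ε = v * e * v := by simp only [hv, mul_assoc]
    rw [h1] at hr
    refine ⟨v * (i u * r) * v, by rw [mul_assoc, hvv], ?_, ?_⟩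
    · rw [mul_assoc v, ← mul_assoc v v, hvv]
    · calc v * (i u * r) * v * (v * e * v) = v * (i u * (r * ((v * v) * e * v))) := by
            simp only [mul_assoc]
        _ = v := by rw [hvv, hr, ← hv, hvv]
  obtain ⟨h, hhv, hvh, hhg⟩ := hli q
  obtain ⟨h', hhv', -, hhh⟩ := hli h
  have h2 : v * h * v = h := by rw [hvh, hhv]
  rw [h2] at hhh
  have h3 : h' = v * q * v := by
    calc h' = h' * v := hhv'.symm
      _ = (h' * h) * (v * q * v) := by rw [mul_assoc, hhg]
      _ = v * q * v := by rw [hhh, mul_assoc v q, ← mul_assoc v v, hvv]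
  rw [h3] at hhh
  have key : ∀ a, u * f a (q * h) = u := by
    intro a
    have h5 : v * (q * h) = v := by
      calc v * (q * h) = v * q * (v * h) := by rw [hvh, mul_assoc v q h]
        _ = v := by rw [← mul_assoc, hhh]
    calc u * f a (q * h) = f a v * f a (q * h) := by rw [hfv]
      _ = u := by rw [← hf, h5, hfv]
  refine ⟨u, h, key, fun a b => ?_⟩
  have h4 : f a (q * h) * u = f a (q * h) := by
    rw [← hfv a, ← hf, mul_assoc, hhv]
  calc f a (q * h) * f b (q * h) = f a (q * h) * (u * f b (q * h)) := by rw [← mul_assoc, h4]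
    _ = _ := by rw [key, h4]

attribute [local instance] Ultrafilter.mul Ultrafilter.semigroup

theorem map_mul_ultra {M N : Type*} [Monoid M] [Monoid N] (f : M →* N) (p q : Ultrafilter M) :
    (p * q).map f = p.map f * q.map f := by
  apply Ultrafilter.coe_inj.mp
  apply Filter.ext'
  intro P
  rw [Ultrafilter.eventually_mul]
  simp only [Ultrafilter.coe_map, Filter.eventually_map]
  rw [Ultrafilter.eventually_mul]
  simp

/-- concatenated word -/
def pre {Sg : Type*} (s : List Sg) (t : ℕ → List (Option Sg)) (a : ℕ → Sg) : ℕ → List Sg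
  | 0 => s
  | n + 1 => pre s t a n ++ a n :: (t n).map (fun o => o.getD (a n))

theorem pre_congr {Sg : Type*} (s : List Sg) (t t' : ℕ → List (Option Sg)) (a a' : ℕ → Sg) (n : ℕ)
    (ht : ∀ i < n, t i = t' i) (ha : ∀ i < n, a i = a' i) : pre s t a n = pre s t' a' n := by
  induction n with
  | zero => rfl
  | succ n ih =>
    simp only [pre]
    rw [ih (fun i hi => ht i (by omega)) (fun i hi => ha i (by omega)), ht n (by omega),
      ha n (by omega)]

/-- Carlson and Simpson: left variable words. -/
theorem carlson_simpson {Sg κ : Type} [Finite Sg] [Nonempty Sg] [Finite κ] (χ₀ : List Sg → κ) :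
    ∃ (s : List Sg) (t : ℕ → List (Option Sg)) (k : κ), ∀ n a, χ₀ (pre s t a n) = k := by
  classical
  let χ : FreeMonoid Sg → κ := χ₀
  let f : Sg → FreeMonoid (Option Sg) →* FreeMonoid Sg := fun a =>
    FreeMonoid.map (fun o => o.getD a)
  let j : FreeMonoid Sg →* FreeMonoid (Option Sg) := FreeMonoid.map some
  obtain ⟨u, y, hu, hz⟩ := exists_absorbing (T₁ := Ultrafilter (FreeMonoid Sg))
    (T₂ := Ultrafilter (FreeMonoid (Option Sg))) (Sg := Sg) Ultrafilter.continuous_mul_left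
    Ultrafilter.continuous_mul_left (fun p => p.map j) (fun a p => p.map (f a))
    (fun a x y => map_mul_ultra (f a) x y)
    (fun a x => by
      rw [Ultrafilter.map_map]
      have : (f a) ∘ j = id := by
        funext w
        simp only [f, j, Function.comp, id, FreeMonoid.map_map]
        have : (fun o : Option Sg => o.getD a) ∘ some = id := by funext; rfl
        rw [this, FreeMonoid.map_id]; rfl
      rw [this, Ultrafilter.map_id])
    (fun x y => map_mul_ultra j x y) (pure (FreeMonoid.of none))
  obtain ⟨k, hk⟩ : ∃ k, ∀ᶠ s : FreeMonoid Sg in (u : Filter (FreeMonoid Sg)), χ s = k := by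
    have : ∀ᶠ s : FreeMonoid Sg in (u : Filter (FreeMonoid Sg)), ∃ k, χ s = k := Eventually.of_forall fun s => ⟨_, rfl⟩
    exact Ultrafilter.eventually_exists_iff.mp this
  -- z a
  have hza : ∀ a (P : FreeMonoid Sg → Prop),
      (∀ᶠ m in (((pure (FreeMonoid.of none) * y).map (f a) : Ultrafilter (FreeMonoid Sg)) :
        Filter (FreeMonoid Sg)), P m) ↔ ∀ᶠ t in (y : Filter (FreeMonoid (Option Sg))),
          P (FreeMonoid.of a * f a t) := by
    intro a P
    rw [Ultrafilter.coe_map, Filter.eventually_map, Ultrafilter.eventually_mul]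
    simp [f]
  let Good : FreeMonoid Sg → Prop := fun s => χ s = k ∧
    ∀ a, ∀ᶠ t in (y : Filter (FreeMonoid (Option Sg))), χ (s * (FreeMonoid.of a * f a t)) = k
  have h0 : ∃ s, Good s := by
    have : ∀ a, ∀ᶠ s : FreeMonoid Sg in (u : Filter (FreeMonoid Sg)),
        ∀ᶠ t in (y : Filter (FreeMonoid (Option Sg))), χ (s * (FreeMonoid.of a * f a t)) = k := by
      intro a
      have h1 := hk
      rw [← hu a, Ultrafilter.eventually_mul] at h1
      filter_upwards [h1] with s hs
      rwa [hza] at hs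
    exact (hk.and (eventually_all.2 this)).exists
  have hstep : ∀ s, Good s → ∀ a, ∀ᶠ t in (y : Filter (FreeMonoid (Option Sg))),
      Good (s * (FreeMonoid.of a * f a t)) := by
    intro s hs a
    refine (hs.2 a).and (eventually_all.2 fun b => ?_)
    have h1 := hs.2 a
    rw [← hza a (fun m => χ (s * m) = k), ← hz a b, Ultrafilter.eventually_mul, hza] at h1
    filter_upwards [h1] with t ht
    rw [hza] at ht
    filter_upwards [ht] with t' ht'
    rw [mul_assoc]; exact ht'
  have hstepF : ∀ F : Set (FreeMonoid Sg), F.Finite → (∀ s ∈ F, Good s) →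
      ∃ t : List (Option Sg), ∀ s ∈ F, ∀ a, Good (s * (FreeMonoid.of a * f a t)) := by
    intro F hF hG
    have : ∀ᶠ t in (y : Filter (FreeMonoid (Option Sg))), ∀ s ∈ F, ∀ a,
        Good (s * (FreeMonoid.of a * f a t)) := by
      rw [Filter.eventually_all_finite hF]
      intro s hs
      exact eventually_all.2 fun a => hstep s (hG s hs) a
    exact this.exists
  choose! T hT using hstepF
  obtain ⟨s, hs⟩ := h0
  let nxt : Set (List Sg) → Set (List Sg) := fun F =>
    ⋃ a : Sg, (fun s : List Sg => s ++ a :: (T F).map (fun o => o.getD a)) '' F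
  let F : ℕ → Set (List Sg) := fun n => nxt^[n] {s}
  have hFs : ∀ n, F (n + 1) = nxt (F n) := fun n => Function.iterate_succ_apply' _ _ _
  have hF : ∀ n, (F n).Finite ∧ ∀ s ∈ F n, Good s := by
    intro n
    induction n with
    | zero =>
      refine ⟨Set.finite_singleton s, ?_⟩
      intro w hw; rw [Set.mem_singleton_iff.1 hw]; exact hs
    | succ n ih =>
      rw [hFs]
      refine ⟨Set.finite_iUnion fun a => ih.1.image _, ?_⟩
      intro w hw
      obtain ⟨a, w', hw', rfl⟩ := Set.mem_iUnion.1 hw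
      exact hT (F n) ih.1 ih.2 w' hw' a
  refine ⟨s, fun n => T (F n), k, fun n a => ?_⟩
  suffices h : pre s (fun n => T (F n)) a n ∈ F n from ((hF n).2 _ h).1
  induction n with
  | zero => exact rfl
  | succ n ih =>
    rw [hFs]
    exact Set.mem_iUnion.2 ⟨a n, _, ih, rfl⟩

/-- Infinite parameter words (rigid surjections `ℕ → ℕ`) with first occurrence map `p`. -/
structure Rig where
  W : ℕ → ℕ
  p : ℕ → ℕ
  hWp : ∀ n, W (p n) = n
  hlt : ∀ n i, i < p n → W i < n

namespace Rig

theorem p_strictMono (R : Rig) : StrictMono R.p := by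
  intro a b hab
  by_contra h
  rcases lt_or_eq_of_le (not_lt.1 h) with h | h
  · have := R.hlt _ _ h
    rw [R.hWp] at this; omega
  · have h1 := R.hWp a
    rw [← h, R.hWp] at h1; omega

theorem le_p (R : Rig) (n : ℕ) : n ≤ R.p n := R.p_strictMono.le_apply

theorem W_le (R : Rig) (i : ℕ) : R.W i ≤ i := by
  have := R.hlt (i + 1) i (R.le_p (i + 1))
  omega

theorem p_zero (R : Rig) : R.p 0 = 0 := by
  by_contra h
  have := R.hlt 0 0 (by omega)
  omega

/-- identity -/
def one : Rig := ⟨id, id, fun _ => rfl, fun _ _ h => h⟩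

/-- composition: first apply `R`, then `Q` on words (as in `R` is the outer word). -/
def comp (R Q : Rig) : Rig where
  W := fun i => Q.W (R.W i)
  p := fun n => R.p (Q.p n)
  hWp := fun n => by rw [R.hWp, Q.hWp]
  hlt := fun n i h => Q.hlt _ _ (R.hlt _ _ h)

end Rig

/-- `c` only depends on the first `L` letters. -/
def Local {κ : Type} (c : ℕ → (ℕ → ℕ) → κ) : Prop :=
  ∀ L U U', (∀ i < L, U i = U' i) → c L U = c L U'

/-- recolouring by a parameter word -/
def recol {κ : Type} (c : ℕ → (ℕ → ℕ) → κ) (R : Rig) : ℕ → (ℕ → ℕ) → κ :=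
  fun L U => c (R.p L) (fun i => U (R.W i))

theorem Local.recol {κ : Type} {c : ℕ → (ℕ → ℕ) → κ} (h : Local c) (R : Rig) :
    Local (recol c R) := by
  intro L U U' hU
  exact h _ _ _ fun i hi => hU _ (R.hlt _ _ hi)

/-- admissible word for level `ℓ` -/
def Adm (B ℓ L : ℕ) (U : ℕ → ℕ) : Prop :=
  ℓ < L ∧ (∀ i < L, ∃ j ≤ ℓ, U i = U j) ∧ ∀ i ≤ ℓ, U i < B

/-- homogeneity at level `ℓ` -/
def Hom {κ : Type} (B : ℕ) (c : ℕ → (ℕ → ℕ) → κ) (ℓ : ℕ) : Prop :=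
  ∀ L L' U U', Adm B ℓ L U → Adm B ℓ L' U' → (∀ i ≤ ℓ, U i = U' i) → c L U = c L' U'

theorem Hom.recol {κ : Type} {B ℓ n : ℕ} {c : ℕ → (ℕ → ℕ) → κ} (h : Hom B c ℓ) (R : Rig)
    (hn : ℓ ≤ n) (hR : ∀ i ≤ n, R.W i = i) : Hom B (recol c R) ℓ := by
  have key : ∀ L U, Adm B ℓ L U → Adm B ℓ (R.p L) (fun i => U (R.W i)) := by
    rintro L U ⟨h1, h2, h3⟩
    refine ⟨lt_of_lt_of_le h1 (R.le_p L), ?_, ?_⟩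
    · intro i hi
      obtain ⟨j, hj, hij⟩ := h2 _ (R.hlt _ _ hi)
      exact ⟨j, hj, by simp only [hR j (by omega), hij]⟩
    · intro i hi
      simp only [hR i (by omega)]; exact h3 i hi
  intro L L' U U' hU hU' hUU
  refine h _ _ _ _ (key _ _ hU) (key _ _ hU') ?_
  intro i hi
  simp only [hR i (by omega)]; exact hUU i hi

section step

variable (l : ℕ) (s : List (Fin (l + 1))) (t : ℕ → List (Option (Fin (l + 1))))

/-- prefixes of the infinite word -/
def Z : ℕ → List ℕ
  | 0 => List.range (l + 1) ++ s.map Fin.val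
  | n + 1 => Z n ++ (l + 1 + n) :: (t n).map (fun o => (o.map Fin.val).getD (l + 1 + n))

theorem Z_mono {n m : ℕ} (h : n ≤ m) : Z l s t n <+: Z l s t m := by
  induction m, h using Nat.le_induction with
  | base => exact List.prefix_rfl
  | succ m _ ih => exact ih.trans (List.prefix_append _ _)

theorem Z_length (n : ℕ) : l + 1 + n ≤ (Z l s t n).length := by
  induction n with
  | zero => simp [Z]
  | succ n ih => simp only [Z, List.length_append, List.length_cons]; omega

theorem Z_lt (n : ℕ) : ∀ x ∈ Z l s t n, x < l + 1 + n := by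
  induction n with
  | zero =>
    intro x hx
    simp only [Z, List.mem_append, List.mem_range, List.mem_map] at hx
    rcases hx with hx | ⟨y, -, rfl⟩
    · omega
    · omega
  | succ n ih =>
    intro x hx
    simp only [Z, List.mem_append, List.mem_cons, List.mem_map] at hx
    rcases hx with hx | rfl | ⟨o, -, rfl⟩
    · have := ih x hx; omega
    · omega
    · cases o with
      | none => simp
      | some y => simp; omega

theorem Z_get {n m i : ℕ} (h : i < (Z l s t n).length) (h' : i < (Z l s t m).length) :
    (Z l s t n)[i] = (Z l s t m)[i] := by
  rcases le_total n m with hh | hh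
  · exact (Z_mono l s t hh).getElem h
  · exact ((Z_mono l s t hh).getElem h').symm

theorem Z_getD {n i : ℕ} (h : i < (Z l s t n).length) :
    (Z l s t i).getD i 0 = (Z l s t n)[i] := by
  have h1 : i < (Z l s t i).length := by have := Z_length l s t i; omega
  rw [List.getD_eq_getElem _ _ h1]
  exact Z_get l s t h1 h

theorem Z_small {i : ℕ} (h : i ≤ l) : (Z l s t i).getD i 0 = i := by
  have h0 := Z_length l s t 0
  rw [Z_getD l s t (n := 0) (by omega)]
  simp only [Z]
  rw [List.getElem_append_left (by simp; omega)]
  simp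

theorem Z_at (n : ℕ) : (Z l s t (Z l s t n).length).getD (Z l s t n).length 0 = l + 1 + n := by
  rw [Z_getD l s t (n := n + 1) (by simp [Z])]
  simp only [Z]
  rw [List.getElem_append_right (le_refl _)]
  simp

/-- the infinite parameter word -/
def ZRig : Rig where
  W := fun i => (Z l s t i).getD i 0
  p := fun m => if m ≤ l then m else (Z l s t (m - (l + 1))).length
  hWp := by
    intro n
    split_ifs with h
    · exact Z_small l s t h
    · rw [Z_at]; omega
  hlt := by
    intro n i hi
    split_ifs at hi with h
    · rw [Z_small l s t (by omega)]; exact hi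
    · rw [Z_getD l s t hi]
      have := Z_lt l s t _ _ (List.getElem_mem hi)
      omega

theorem Z_map (a : ℕ → Fin (l + 1)) (U : ℕ → ℕ) (n : ℕ)
    (hU : ∀ i < n, U (l + 1 + i) = U (a i)) :
    (Z l s t n).map U = (List.ofFn (fun i : Fin (l + 1) => U i)) ++
      (pre s t a n).map (fun i : Fin (l + 1) => U i) := by
  induction n with
  | zero =>
    simp only [Z, pre, List.map_append, List.map_map]
    congr 1
    apply List.ext_getElem
    · simp
    · intro i h1 h2
      rw [List.getElem_ofFn]
      simp
  | succ n ih =>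
    simp only [Z, pre, List.map_append, List.map_map, List.map_cons]
    rw [ih (fun i hi => hU i (by omega)), List.append_assoc, hU n (by omega)]
    congr 3
    apply List.map_congr_left
    intro o _
    cases o with
    | none => simpa using hU n (by omega)
    | some y => simp

end step

theorem step {κ : Type} [Finite κ] (B : ℕ) (c : ℕ → (ℕ → ℕ) → κ) (hc : Local c) (l : ℕ) :
    ∃ R : Rig, (∀ i ≤ l, R.W i = i) ∧ (∀ i ≤ l, R.p i = i) ∧ Hom B (recol c R) l := by
  let cl : List ℕ → κ := fun w => c w.length (fun i => w.getD i 0)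
  let χ : List (Fin (l + 1)) → ((Fin (l + 1) → Fin B) → κ) := fun V g =>
    cl (List.ofFn (fun i => (g i : ℕ)) ++ V.map (fun i => (g i : ℕ)))
  obtain ⟨s, t, k, hk⟩ := carlson_simpson χ
  refine ⟨ZRig l s t, fun i hi => Z_small l s t hi, fun i hi => if_pos hi, ?_⟩
  have key : ∀ L U (hA : Adm B l L U),
      recol c (ZRig l s t) L U = k (fun i => ⟨U i, hA.2.2 i (by omega)⟩) := by
    intro L U hA
    obtain ⟨n, rfl⟩ : ∃ n, L = l + 1 + n := ⟨L - (l + 1), by have := hA.1; omega⟩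
    have : ∀ i, ∃ a : Fin (l + 1), i < n → U (l + 1 + i) = U a := by
      intro i
      by_cases hi : i < n
      · obtain ⟨j, hj, hij⟩ := hA.2.1 (l + 1 + i) (by omega)
        exact ⟨⟨j, by omega⟩, fun _ => hij⟩
      · exact ⟨0, fun h => absurd h hi⟩
    choose a ha using this
    rw [← hk n a]
    simp only [χ, cl]
    have hm := Z_map l s t a U n ha
    rw [← hm]
    have hp : (ZRig l s t).p (l + 1 + n) = (Z l s t n).length := by
      simp only [ZRig]
      rw [if_neg (by omega)]
      congr 2; omega
    simp only [recol, hp, List.length_map]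
    apply hc
    intro i hi
    rw [List.getD_eq_getElem _ _ (by simpa using hi), List.getElem_map, ← Z_getD l s t hi]
    rfl
  intro L L' U U' hU hU' hUU
  rw [key L U hU, key L' U' hU']
  congr 1
  funext i
  exact Fin.ext (hUU i (by omega))

theorem fusion {κ : Type} [Finite κ] (B : ℕ) (c : ℕ → (ℕ → ℕ) → κ) (hc : Local c) :
    ∃ R : Rig, ∀ l, Hom B (recol c R) l := by
  choose F hF1 hF2 hF3 using fun (R : Rig) (l : ℕ) => step B (recol c R) (hc.recol R) l
  let G : ℕ → Rig := fun n => Nat.rec Rig.one (fun n R => R.comp (F R n)) n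
  have hG : ∀ n, G (n + 1) = (G n).comp (F (G n) n) := fun n => rfl
  have hHom : ∀ l n, l < n → Hom B (recol c (G n)) l := by
    intro l n hn
    induction n, hn using Nat.le_induction with
    | base => exact hF3 (G l) l
    | succ n hn ih =>
      exact ih.recol (F (G n) n) (by omega) (hF1 _ _)
  have hW : ∀ i n, i ≤ n → (G n).W i = (G i).W i := by
    intro i n hn
    induction n, hn using Nat.le_induction with
    | base => rfl
    | succ n hn ih =>
      rw [hG]
      change (F (G n) n).W ((G n).W i) = _
      rw [hF1 _ _ _ (((G n).W_le i).trans hn), ih]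
  have hp : ∀ i n, i ≤ n → (G n).p i = (G i).p i := by
    intro i n hn
    induction n, hn using Nat.le_induction with
    | base => rfl
    | succ n hn ih =>
      rw [hG]
      change (G n).p ((F (G n) n).p i) = _
      rw [hF2 _ _ _ hn, ih]
  let R : Rig :=
    { W := fun i => (G i).W i
      p := fun i => (G i).p i
      hWp := by
        intro n
        have h := (G n).le_p n
        have h2 : (G ((G n).p n)).W ((G ((G n).p n)).p n) = n := (G _).hWp n
        rw [hp n _ h] at h2
        exact h2
      hlt := by
        intro n i hi
        rw [← hp n (max n i) (le_max_left _ _)] at hi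
        rw [← hW i (max n i) (le_max_right _ _)]
        exact (G _).hlt _ _ hi }
  have hR : ∀ L U, ∃ N, ∀ n, N ≤ n → recol c R L U = recol c (G n) L U := by
    intro L U
    refine ⟨R.p L, fun n hn => ?_⟩
    have h1 : (G n).p L = R.p L := hp L n ((R.le_p L).trans hn)
    simp only [recol, h1]
    apply hc
    intro i hi
    rw [hW i n (by omega)]
  refine ⟨R, fun l => ?_⟩
  intro L L' U U' hU hU' hUU
  obtain ⟨N, hN⟩ := hR L U
  obtain ⟨N', hN'⟩ := hR L' U'
  rw [hN (max (max N N') (l + 1)) (by omega), hN' (max (max N N') (l + 1)) (by omega)]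
  exact hHom l _ (by omega) _ _ _ _ hU hU' hUU

/-- finite `d`-parameter words -/
def Rg : ℕ → ℕ → (ℕ → ℕ) → Prop
  | 0, L, _ => L = 0
  | d + 1, L, U => ∃ l < L, Rg d l U ∧ U l = d ∧ ∀ i < L, U i < d + 1

theorem Rg.act {d L : ℕ} {U : ℕ → ℕ} (h : Rg d L U) (R : Rig) :
    Rg d (R.p L) (fun i => U (R.W i)) := by
  induction d generalizing L with
  | zero =>
    have : L = 0 := h
    subst this
    exact R.p_zero
  | succ d ih =>
    obtain ⟨l, hl, h1, h2, h3⟩ := h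
    refine ⟨R.p l, R.p_strictMono hl, ih h1, ?_, fun i hi => h3 _ (R.hlt _ _ hi)⟩
    simp only [R.hWp, h2]

theorem Rg.surj {d L : ℕ} {U : ℕ → ℕ} (h : Rg d L U) : ∀ j < d, ∃ i < L, U i = j := by
  induction d generalizing L with
  | zero => intro j hj; omega
  | succ d ih =>
    obtain ⟨l, hl, h1, h2, h3⟩ := h
    intro j hj
    rcases Nat.lt_succ_iff_lt_or_eq.1 hj with hj | rfl
    · obtain ⟨i, hi, e⟩ := ih h1 j hj
      exact ⟨i, by omega, e⟩
    · exact ⟨l, hl, h2⟩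

theorem Rg.lt {d L : ℕ} {U : ℕ → ℕ} (h : Rg d L U) : ∀ i < L, U i < d := by
  cases d with
  | zero => intro i hi; have : L = 0 := h; omega
  | succ d => exact h.choose_spec.2.2.2

theorem dual_ramsey (d : ℕ) : ∀ {κ : Type} [Finite κ] (c : ℕ → (ℕ → ℕ) → κ), Local c →
    ∃ R : Rig, ∀ d' ≤ d, ∀ L L' U U', Rg d' L U → Rg d' L' U' →
      recol c R L U = recol c R L' U' := by
  induction d with
  | zero =>
    intro κ _ c hc
    refine ⟨Rig.one, ?_⟩
    intro d' hd' L L' U U' h h'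
    obtain rfl : d' = 0 := by omega
    have h1 : L = 0 := h
    have h2 : L' = 0 := h'
    subst h1 h2
    exact hc.recol _ _ _ _ (fun i hi => by omega)
  | succ d ih =>
    intro κ _ c hc
    obtain ⟨R, hR⟩ := fusion (d + 1) c hc
    have hcR := hc.recol R
    let c₂ : ℕ → (ℕ → ℕ) → κ × κ := fun L U =>
      (recol c R L U, recol c R (L + 1) (Function.update U L d))
    have hc₂ : Local c₂ := by
      intro L U U' h
      refine Prod.ext (hcR _ _ _ h) (hcR _ _ _ fun i hi => ?_)
      by_cases hiL : i = L
      · subst hiL; simp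
      · simp only [Function.update_of_ne hiL]
        exact h i (by omega)
    obtain ⟨Q, hQ⟩ := ih c₂ hc₂
    refine ⟨R.comp Q, ?_⟩
    intro d' hd' L L' U U' h h'
    rcases Nat.lt_or_ge d d' with hd | hd
    · obtain rfl : d' = d + 1 := by omega
      have key : ∀ L U l, l < L → Rg d l U → U l = d → (∀ i < L, U i < d + 1) →
          recol c (R.comp Q) L U = (recol c₂ Q l U).2 := by
        intro L U l hl h1 h2 h3
        have hs : ∀ x < d + 1, ∃ j ≤ Q.p l, U (Q.W j) = x := by
          intro x hx
          rcases Nat.lt_succ_iff_lt_or_eq.1 hx with hx | rfl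
          · obtain ⟨i, hi, e⟩ := (h1.act Q).surj x hx
            exact ⟨i, by omega, e⟩
          · exact ⟨Q.p l, le_rfl, by rw [Q.hWp, h2]⟩
        have hub : ∀ i, Function.update (fun i => U (Q.W i)) (Q.p l) d i = U (Q.W i) := by
          intro i
          by_cases hi : i = Q.p l
          · subst hi; simp [Q.hWp, h2]
          · simp [Function.update_of_ne hi]
        have hpl := Q.p_strictMono hl
        have hvl : ∀ i < Q.p L, U (Q.W i) < d + 1 := fun i hi => h3 _ (Q.hlt _ _ hi)
        change recol c R (Q.p L) (fun i => U (Q.W i)) =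
          recol c R (Q.p l + 1) (Function.update (fun i => U (Q.W i)) (Q.p l) d)
        refine hR (Q.p l) (Q.p L) (Q.p l + 1) _ _ ⟨hpl, ?_, ?_⟩ ⟨by omega, ?_, ?_⟩ ?_
        · intro i hi
          obtain ⟨j, hj, e⟩ := hs _ (hvl i hi)
          exact ⟨j, hj, e.symm⟩
        · intro i hi
          exact hvl i (by omega)
        · intro i hi
          exact ⟨i, by omega, rfl⟩
        · intro i hi
          rw [hub]
          exact hvl i (by omega)
        · intro i hi
          exact (hub i).symm
      obtain ⟨l, hl, h1, h2, h3⟩ := h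
      obtain ⟨l', hl', h1', h2', h3'⟩ := h'
      rw [key L U l hl h1 h2 h3, key L' U' l' hl' h1' h2' h3', hQ d le_rfl _ _ _ _ h1 h1']
    · exact congrArg Prod.fst (hQ d' hd _ _ _ _ h h')

theorem Rg.congr {d L : ℕ} {U U' : ℕ → ℕ} (h : Rg d L U) (hU : ∀ i < L, U i = U' i) :
    Rg d L U' := by
  induction d generalizing L with
  | zero => exact h
  | succ d ih =>
    obtain ⟨l, hl, h1, h2, h3⟩ := h
    refine ⟨l, hl, ih h1 (fun i hi => hU i (by omega)), by rw [← hU l hl, h2], ?_⟩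
    intro i hi
    rw [← hU i hi]; exact h3 i hi

theorem envelope {Col : Type} (C : ℕ → Col) (L : ℕ) :
    ∃ (d : ℕ) (U : ℕ → ℕ) (g : ℕ → Col), Rg d L U ∧ (∀ i < L, C i = g (U i)) ∧
      Set.InjOn g (Set.Iio d) := by
  classical
  induction L with
  | zero => exact ⟨0, id, fun _ => C 0, rfl, fun i hi => by omega, fun i hi => by simp at hi⟩
  | succ L ih =>
    obtain ⟨d, U, g, h1, h2, h3⟩ := ih
    have hU : ∀ x, ∀ i < L, U i = Function.update U L x i := by
      intro x i hi
      rw [Function.update_of_ne (by omega)]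
    by_cases hj : ∃ j < d, C L = g j
    · obtain ⟨j, hj, e⟩ := hj
      refine ⟨d, Function.update U L j, g, ?_, ?_, h3⟩
      · have h4 := h1.congr (hU j)
        cases d with
        | zero => omega
        | succ d =>
          obtain ⟨l, hl, k1, k2, k3⟩ := h4
          refine ⟨l, by omega, k1, k2, fun i hi => ?_⟩
          rcases Nat.lt_succ_iff_lt_or_eq.1 hi with hi | rfl
          · exact k3 i hi
          · simpa using hj
      · intro i hi
        rcases Nat.lt_succ_iff_lt_or_eq.1 hi with hi | rfl
        · rw [← hU j i hi]; exact h2 i hi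
        · simpa using e
    · push Not at hj
      refine ⟨d + 1, Function.update U L d, Function.update g d (C L), ?_, ?_, ?_⟩
      · refine ⟨L, by omega, h1.congr (hU d), by simp, fun i hi => ?_⟩
        rcases Nat.lt_succ_iff_lt_or_eq.1 hi with hi | rfl
        · rw [← hU d i hi]
          have := h1.lt i hi
          omega
        · simp
      · intro i hi
        rcases Nat.lt_succ_iff_lt_or_eq.1 hi with hi | rfl
        · have := h1.lt i hi
          rw [← hU d i hi, Function.update_of_ne (by omega)]; exact h2 i hi
        · simp
      · intro i hi j hj' e
        simp only [Set.mem_Iio] at hi hj'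
        rcases Nat.lt_succ_iff_lt_or_eq.1 hi with hi | rfl
        · rcases Nat.lt_succ_iff_lt_or_eq.1 hj' with hj' | rfl
          · rw [Function.update_of_ne (by omega), Function.update_of_ne (by omega)] at e
            exact h3 hi hj' e
          · rw [Function.update_of_ne (by omega)] at e
            simp only [Function.update_self] at e
            exact absurd e.symm (hj i hi)
        · rcases Nat.lt_succ_iff_lt_or_eq.1 hj' with hj' | rfl
          · rw [Function.update_self, Function.update_of_ne (by omega)] at e
            exact absurd e (hj j hj')
          · rfl

/-- nodes of the binary tree, coded as `0,2`-words followed by `1`s -/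
def X : Type := {x : Lex (ℕ → Fin 3) // ∃ L : ℕ, ∀ i, x i = 1 ↔ L ≤ i}

noncomputable instance : LinearOrder X := inferInstanceAs (LinearOrder (Subtype _))

/-- coercion -/
def X.fn (x : X) : ℕ → Fin 3 := fun i => x.1 i

/-- length -/
noncomputable def X.len (x : X) : ℕ := x.2.choose

theorem X.fn_eq_one (x : X) (i : ℕ) : x.fn i = 1 ↔ x.len ≤ i := x.2.choose_spec i

theorem X.ext {x y : X} (h : ∀ i, x.fn i = y.fn i) : x = y := Subtype.ext (funext h)

theorem X.lt_iff (x y : X) : x < y ↔ ∃ i, (∀ j < i, x.fn j = y.fn j) ∧ x.fn i < y.fn i := Iff.rfl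

open Classical in
/-- normal form -/
noncomputable def norm (M : ℕ) (y : ℕ → Fin 3) : X :=
  ⟨toLex fun j => if j < M ∧ ∀ i ≤ j, y i ≠ 1 then y j else 1, by
    have hex : ∃ L, M ≤ L ∨ y L = 1 := ⟨M, Or.inl le_rfl⟩
    refine ⟨Nat.find hex, fun j => ?_⟩
    rw [Nat.find_le_iff]
    simp only [Pi.toLex_apply]
    constructor
    · intro h
      split_ifs at h with hh
      · exact absurd h (hh.2 j le_rfl)
      · by_contra hc
        push Not at hc
        exact hh ⟨(hc j le_rfl).1, fun i hi => (hc i hi).2⟩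
    · rintro ⟨m, hm, h⟩
      rw [if_neg]
      rintro ⟨h1, h2⟩
      rcases h with h | h
      · omega
      · exact h2 m hm h⟩

open Classical in
theorem norm_fn (M : ℕ) (y : ℕ → Fin 3) (j : ℕ) :
    (norm M y).fn j = if j < M ∧ ∀ i ≤ j, y i ≠ 1 then y j else 1 := rfl

theorem norm_congr {M : ℕ} {y y' : ℕ → Fin 3} (h : ∀ i < M, y i = y' i) :
    norm M y = norm M y' := by
  apply X.ext
  intro j
  rw [norm_fn, norm_fn]
  by_cases hj : j < M
  · have : (∀ i ≤ j, y i ≠ 1) ↔ (∀ i ≤ j, y' i ≠ 1) :=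
      forall₂_congr fun i hi => by rw [h i (by omega)]
    simp only [this, h j hj]
  · rw [if_neg (fun h => hj h.1), if_neg (fun h => hj h.1)]

/-- action of a parameter word on nodes -/
noncomputable def act (R : Rig) (x : X) : X := norm (R.p x.len) (fun i => x.fn (R.W i))

theorem act_fn (R : Rig) (x : X) (j : ℕ) :
    (act R x).fn j = if j < R.p x.len then x.fn (R.W j) else 1 := by
  rw [act, norm_fn]
  by_cases hj : j < R.p x.len
  · rw [if_pos hj, if_pos]
    refine ⟨hj, fun i hi => ?_⟩
    rw [Ne, X.fn_eq_one, not_le]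
    exact R.hlt _ _ (by omega)
  · rw [if_neg hj, if_neg (fun h => hj h.1)]

theorem act_eq (R : Rig) (x : X) {L : ℕ} (hL : x.len ≤ L) :
    act R x = norm (R.p L) (fun i => x.fn (R.W i)) := by
  apply X.ext
  intro j
  have hm := R.p_strictMono.monotone hL
  rw [act_fn, norm_fn]
  by_cases hj : j < R.p x.len
  · rw [if_pos hj, if_pos]
    refine ⟨by omega, fun i hi => ?_⟩
    rw [Ne, X.fn_eq_one, not_le]
    exact R.hlt _ _ (by omega)
  · rw [if_neg hj, if_neg]
    rintro ⟨-, h⟩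
    apply h (R.p x.len) (by omega)
    rw [R.hWp, X.fn_eq_one]

theorem lt_len {x y : X} {i : ℕ} (h : ∀ j < i, x.fn j = y.fn j) (hne : x.fn i ≠ y.fn i) :
    i ≤ x.len := by
  by_contra hc
  push Not at hc
  have h1 : x.fn x.len = 1 := (x.fn_eq_one _).2 le_rfl
  have h2 := h _ hc
  rw [h1] at h2
  have h3 := (y.fn_eq_one _).1 h2.symm
  exact hne (((x.fn_eq_one _).2 hc.le).trans ((y.fn_eq_one _).2 (by omega)).symm)

theorem act_strictMono (R : Rig) : StrictMono (act R) := by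
  intro x y hxy
  rw [X.lt_iff] at hxy ⊢
  obtain ⟨i, h, hi⟩ := hxy
  have hx := lt_len h hi.ne
  have hy := lt_len (fun j hj => (h j hj).symm) hi.ne'
  have key : ∀ z : X, i ≤ z.len → (act R z).fn (R.p i) = z.fn i := by
    intro z hz
    rw [act_fn, R.hWp]
    split_ifs with h1
    · rfl
    · rcases hz.lt_or_eq with h2 | h2
      · exact absurd (R.p_strictMono h2) h1
      · exact ((z.fn_eq_one _).2 h2.ge).symm
  refine ⟨R.p i, fun j hj => ?_, ?_⟩
  · have mx := R.p_strictMono.monotone hx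
    have my := R.p_strictMono.monotone hy
    rw [act_fn, act_fn, if_pos (by omega), if_pos (by omega)]
    exact h _ (R.hlt _ _ hj)
  · rw [key x hx, key y hy]; exact hi

instance : Countable X := by
  have : Function.Injective (fun x : X => (⟨x.len, fun i => x.fn i⟩ : Σ L : ℕ, Fin L → Fin 3)) := by
    intro x y h
    simp only [Sigma.mk.injEq] at h
    obtain ⟨h1, h2⟩ := h
    apply X.ext
    intro i
    by_cases hi : i < x.len
    · have : ∀ (L L' : ℕ) (f g : ℕ → Fin 3), L = L' →
        ((fun i : Fin L => f i) ≍ (fun i : Fin L' => g i)) → ∀ i < L, f i = g i := by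
        rintro L _ f g rfl h i hi
        exact congrFun (eq_of_heq h) ⟨i, hi⟩
      exact this _ _ _ _ h1 h2 i hi
    · rw [(x.fn_eq_one i).2 (by omega), (y.fn_eq_one i).2 (by omega)]
  exact this.countable

/-- extend a node by one letter -/
noncomputable def X.ext1 (x : X) (b : Fin 3) : X :=
  norm (x.len + 1) (Function.update x.fn x.len b)

theorem X.ext1_fn_lt (x : X) (b : Fin 3) {i : ℕ} (hi : i < x.len) :
    (x.ext1 b).fn i = x.fn i := by
  rw [X.ext1, norm_fn, if_pos, Function.update_of_ne hi.ne]
  refine ⟨by omega, fun j hj => ?_⟩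
  rw [Function.update_of_ne (by omega), Ne, X.fn_eq_one]; omega

theorem X.ext1_fn_len (x : X) (b : Fin 3) (hb : b ≠ 1) :
    (x.ext1 b).fn x.len = b := by
  rw [X.ext1, norm_fn, if_pos, Function.update_self]
  refine ⟨by omega, fun j hj => ?_⟩
  rcases hj.lt_or_eq with hj | rfl
  · rw [Function.update_of_ne (by omega), Ne, X.fn_eq_one]; omega
  · simpa using hb

theorem X.lt_ext1 (x : X) : x < x.ext1 2 := by
  rw [X.lt_iff]
  refine ⟨x.len, fun j hj => (x.ext1_fn_lt 2 hj).symm, ?_⟩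
  rw [x.ext1_fn_len 2 (by decide), (x.fn_eq_one _).2 le_rfl]; decide

theorem X.ext1_lt (x : X) : x.ext1 0 < x := by
  rw [X.lt_iff]
  refine ⟨x.len, fun j hj => (x.ext1_fn_lt 0 hj), ?_⟩
  rw [x.ext1_fn_len 0 (by decide), (x.fn_eq_one _).2 le_rfl]; decide

instance : Nontrivial X := ⟨⟨norm 0 0, (norm 0 0).ext1 2, (X.lt_ext1 _).ne⟩⟩

instance : DenselyOrdered X := by
  refine ⟨fun x y hxy => ?_⟩
  obtain ⟨i, h, hi⟩ := (X.lt_iff x y).1 hxy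
  have hx := lt_len h hi.ne
  have hy := lt_len (fun j hj => (h j hj).symm) hi.ne'
  by_cases h1 : x.fn i = 1
  · have h2 : i < y.len := by
      by_contra hc
      rw [h1, (y.fn_eq_one i).2 (by omega)] at hi
      exact lt_irrefl _ hi
    refine ⟨y.ext1 0, (X.lt_iff _ _).2 ⟨i, fun j hj => ?_, ?_⟩, y.ext1_lt⟩
    · rw [y.ext1_fn_lt 0 (by omega)]; exact h j hj
    · rw [y.ext1_fn_lt 0 h2]; exact hi
  · have h2 : i < x.len := by
      rw [X.fn_eq_one] at h1; omega
    refine ⟨x.ext1 2, x.lt_ext1, (X.lt_iff _ _).2 ⟨i, fun j hj => ?_, ?_⟩⟩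
    · rw [x.ext1_fn_lt 2 (by omega)]; exact h j hj
    · rw [x.ext1_fn_lt 2 h2]; exact hi

end BigRamsey

open BigRamsey in
theorem rationals_finite_big_ramsey_degrees
    (A : Type) [LinearOrder A] [Finite A] :
    ∃ D : ℕ, ∀ k : ℕ, 1 ≤ k → ∀ χ : (A ↪o ℚ) → Fin k, ∃ f : ℚ ↪o ℚ,
      Set.ncard { c : Fin k | ∃ e : A ↪o ℚ, Set.range ⇑e ⊆ Set.range ⇑f ∧ χ e = c } ≤ D := by
  classical
  let N := Nat.card (A → Fin 3)
  refine ⟨Nat.card (Fin (N + 1) × (Fin N → (A → Fin 3))), fun k hk χ => ?_⟩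
  obtain ⟨r⟩ := Order.embedding_from_countable_to_dense (α := X) (β := ℚ)
  obtain ⟨h⟩ := Order.embedding_from_countable_to_dense (α := ℚ) (β := X)
  let χ' : (A → X) → Fin k := fun z =>
    if hz : ∃ e : A ↪o ℚ, ∀ a, e a = r (z a) then χ hz.choose else ⟨0, hk⟩
  have hχ' : ∀ z (e : A ↪o ℚ), (∀ a, e a = r (z a)) → χ' z = χ e := by
    intro z e he
    have hz : ∃ e : A ↪o ℚ, ∀ a, e a = r (z a) := ⟨e, he⟩
    simp only [χ', dif_pos hz]
    congr 1
    ext a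
    rw [hz.choose_spec a, he a]
  let hat : (Fin N → (A → Fin 3)) → ℕ → A → Fin 3 := fun g i =>
    if hi : i < N then g ⟨i, hi⟩ else fun _ => 1
  let c : ℕ → (ℕ → ℕ) → ((Fin N → (A → Fin 3)) → Fin k) := fun L Y g =>
    χ' (fun a => BigRamsey.norm L (fun j => hat g (Y j) a))
  have hc : Local c := by
    intro L U U' hU
    funext g
    simp only [c]
    congr 1
    funext a
    apply norm_congr
    intro i hi
    rw [hU i hi]
  obtain ⟨R, hR⟩ := dual_ramsey N c hc
  have hΦ : ∀ dg : Fin (N + 1) × (Fin N → (A → Fin 3)), ∃ col : Fin k, ∀ L U,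
      Rg dg.1 L U → recol c R L U dg.2 = col := by
    rintro ⟨d, g⟩
    by_cases hex : ∃ L U, Rg d L U
    · obtain ⟨L, U, hLU⟩ := hex
      exact ⟨recol c R L U g, fun L' U' h' =>
        congrFun (hR d (by omega) _ _ _ _ h' hLU) g⟩
    · exact ⟨⟨0, hk⟩, fun L U h' => absurd ⟨L, U, h'⟩ hex⟩
  choose Φ hΦ using hΦ
  let f : ℚ ↪o ℚ := (h.trans (OrderEmbedding.ofStrictMono (act R) (act_strictMono R))).trans r
  have hf : ∀ q, f q = r (act R (h q)) := fun q => rfl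
  refine ⟨f, ?_⟩
  have hsub : { c : Fin k | ∃ e : A ↪o ℚ, Set.range ⇑e ⊆ Set.range ⇑f ∧ χ e = c } ⊆
      Φ '' Set.univ := by
    rintro _ ⟨e, he, rfl⟩
    have : ∀ a, ∃ q, f q = e a := fun a => he ⟨a, rfl⟩
    choose q hq using this
    let x : A → X := fun a => h (q a)
    obtain ⟨L, hL⟩ : ∃ L, ∀ a, (x a).len ≤ L := by
      obtain ⟨L, hL⟩ := (Set.finite_range (fun a => (x a).len)).bddAbove
      exact ⟨L, fun a => hL ⟨a, rfl⟩⟩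
    obtain ⟨d, U, g, h1, h2, h3⟩ := envelope (fun i a => (x a).fn i) L
    have hd : d ≤ N := by
      have : Function.Injective (fun i : Fin d => g i) := by
        intro i j hij
        exact Fin.ext (h3 i.2 j.2 hij)
      have := Nat.card_le_card_of_injective _ this
      simpa using this
    refine ⟨(⟨d, by omega⟩, fun i => g i), trivial, ?_⟩
    rw [← hΦ (⟨d, by omega⟩, fun i => g i) L U h1]
    simp only [recol, c]
    apply hχ'
    intro a
    rw [← hq a, hf]
    congr 1
    rw [act_eq R (h (q a)) (hL a)]
    apply norm_congr
    intro i hi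
    have hi' := R.hlt _ _ hi
    have h4 := h1.lt _ hi'
    simp only [hat]
    rw [dif_pos (by omega)]
    exact congrFun (h2 _ hi') a
  calc _ ≤ (Φ '' Set.univ).ncard := Set.ncard_le_ncard hsub (Set.toFinite _)
    _ ≤ (Set.univ : Set (Fin (N + 1) × (Fin N → (A → Fin 3)))).ncard :=
      Set.ncard_image_le (Set.toFinite _)
    _ = _ := Set.ncard_univ _
end
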